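/- Let S ∈ Ω_{j−1} be normalized. Then for every X ∈ Ω_j, X e S holds if and only if there exists p in the Aut(U_{j−1})-orbit of u_j such that underline(X) = U_{j−1} ∪ {p} and the restriction of X to U_{j−1} equals S. -/

import Mathlib

/-!
We model the setting of the paper: `U` and `R` are finite sets, `Γ` is a
subgroup of `Sym(U)` (here `Equiv.Perm U`).  A partial assignment `X : W → R`
with `W ⊆ U` is modeled as a function `U → Option R` whose domain
(`underline X`) is the set of points where it is `some`.  The paper's right
action is rendered as the corresponding (mirror) left action:
`(γ • X)(u) = X(γ⁻¹ u)`, points are acted on by `u ↦ γ u` and sets by images.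
-/

namespace PrefixAssignment

variable {U R : Type*}

/-- The domain `underline X` of a partial assignment. -/
def dom (X : U → Option R) : Set U := {u | X u ≠ none}

/-- The action of a permutation `γ` on a partial assignment:
`(psmul γ X)(u) = X(γ⁻¹ u)` (left-action form of the paper's
`X^γ(u) = X(u^{γ⁻¹})`). -/
def psmul (γ : Equiv.Perm U) (X : U → Option R) : U → Option R :=
  fun u => X (γ⁻¹ u)

open scoped Classical in
/-- Restriction of a partial assignment to a set `W` of variables. -/
noncomputable def restrict (X : U → Option R) (W : Set U) : U → Option R :=
  fun u => if u ∈ W then X u else none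

/-- `Uset u j = U_j = {u_1, …, u_j}` (`u` is 0-indexed). -/
def Uset {k : ℕ} (u : Fin k → U) (j : ℕ) : Set U :=
  {x | ∃ i : Fin k, (i : ℕ) < j ∧ u i = x}

/-- `Ω_j`: partial assignments whose domain lies in the `Γ`-orbit of `U_j`. -/
def OmegaJ (Γ : Subgroup (Equiv.Perm U)) {k : ℕ} (u : Fin k → U) (j : ℕ)
    (X : U → Option R) : Prop :=
  ∃ γ ∈ Γ, ⇑γ '' dom X = Uset u j

/-- The extension relation `e ⊆ Ω_j × Ω_{j-1}`:  `erel Γ u j X S` holds iff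
there is `γ ∈ Γ` taking the domain of `X` to `U_j`, the domain of `S` to
`U_{j-1}`, and the restriction of `γ • X` to `U_{j-1}` to `γ • S`. -/
def erel (Γ : Subgroup (Equiv.Perm U)) {k : ℕ} (u : Fin k → U) (j : ℕ)
    (X S : U → Option R) : Prop :=
  ∃ γ ∈ Γ, ⇑γ '' dom X = Uset u j ∧ ⇑γ '' dom S = Uset u (j - 1) ∧
    restrict (psmul γ X) (Uset u (j - 1)) = psmul γ S

/-- The setwise stabilizer `Aut(W)` of `W ⊆ U` in `Γ`. -/
def AutSet (Γ : Subgroup (Equiv.Perm U)) (W : Set U) : Set (Equiv.Perm U) :=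
  {γ | γ ∈ Γ ∧ ⇑γ '' W = W}

/-- The automorphism group (stabilizer) `Aut(S)` of a partial assignment `S` in `Γ`. -/
def AutAsg (Γ : Subgroup (Equiv.Perm U)) (S : U → Option R) : Set (Equiv.Perm U) :=
  {γ | γ ∈ Γ ∧ psmul γ S = S}

/-- The orbit of a point `p ∈ U` under a set `A` of permutations. -/
def ptOrbit (A : Set (Equiv.Perm U)) (p : U) : Set U :=
  {q | ∃ γ ∈ A, γ p = q}


/-- For a normalized seed `S ∈ Ω_{j-1}`: an `X ∈ Ω_j` extends `S` iff there is
a `p` in the `Aut(U_{j-1})`-orbit of `u_j` with `underline X = U_{j-1} ∪ {p}`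
and `X` restricted to `U_{j-1}` equal to `S`. -/
theorem stmt_9 {U R : Type*} [Finite U] [Finite R]
    (Γ : Subgroup (Equiv.Perm U)) {k : ℕ} (u : Fin k → U)
    (hu : Function.Injective u)
    (j : ℕ) (hj1 : 1 ≤ j) (hjk : j ≤ k)
    (S : U → Option R)
    (hS : OmegaJ Γ u (j - 1) S)
    (hSnorm : dom S = Uset u (j - 1)) :
    ∀ X : U → Option R, OmegaJ Γ u j X →
      (erel Γ u j X S ↔
        ∃ p ∈ ptOrbit (AutSet Γ (Uset u (j - 1))) (u ⟨j - 1, by omega⟩),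
          dom X = Uset u (j - 1) ∪ {p} ∧ restrict X (Uset u (j - 1)) = S) := by
  intro X _
  have hU : Uset u j = insert (u ⟨j - 1, by omega⟩) (Uset u (j - 1)) := by
    ext x
    simp only [Uset, Set.mem_insert_iff, Set.mem_ofPred_eq]
    constructor
    · rintro ⟨i, hi, rfl⟩
      by_cases h : (i : ℕ) < j - 1
      · exact Or.inr ⟨i, h, rfl⟩
      · left
        congr 1
        apply Fin.ext
        simp only
        omega
    · rintro (rfl | ⟨i, hi, rfl⟩)
      · exact ⟨_, by simp only; omega, rfl⟩
      · exact ⟨i, by omega, rfl⟩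
  unfold erel
  rw [hSnorm, hU]
  generalize u ⟨j - 1, by omega⟩ = q
  generalize Uset u (j - 1) = V at *
  have key : ∀ (γ : Equiv.Perm U) (A B : Set U),
      ⇑γ '' A = B ↔ ∀ x, x ∈ A ↔ γ x ∈ B := by
    intro γ A B
    constructor
    · rintro rfl x
      simp
    · intro h
      ext y
      obtain ⟨x, rfl⟩ := γ.surjective y
      simp [h]
  constructor
  · rintro ⟨γ, hγ, h1, h2, h3⟩
    rw [key] at h1 h2
    refine ⟨γ⁻¹ q, ⟨γ⁻¹, ⟨Γ.inv_mem hγ, ?_⟩, rfl⟩, ?_, ?_⟩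
    · rw [key]
      intro x
      rw [h2 (γ⁻¹ x)]
      simp
    · ext x
      rw [h1 x, Set.mem_insert_iff, ← h2 x, Set.mem_union, Set.mem_singleton_iff,
        Equiv.Perm.eq_inv_iff_eq, or_comm]
    · funext x
      have := congrFun h3 (γ x)
      have hx := h2 x
      by_cases h : x ∈ V
      · have h' := hx.1 h
        simpa [restrict, psmul, h, h'] using this
      · have h' : γ x ∉ V := fun t => h (hx.2 t)
        simpa [restrict, psmul, h, h'] using this
  · rintro ⟨p, ⟨γ, ⟨hγ, h2⟩, rfl⟩, h1, h3⟩
    rw [key] at h2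
    have h2' : ∀ x, x ∈ V ↔ γ⁻¹ x ∈ V := by
      intro x
      rw [h2 (γ⁻¹ x)]
      simp
    refine ⟨γ⁻¹, Γ.inv_mem hγ, ?_, ?_, ?_⟩
    · rw [key]
      intro x
      rw [h1, Set.mem_insert_iff, ← h2' x, Set.mem_union, Set.mem_singleton_iff,
        Equiv.Perm.inv_eq_iff_eq, or_comm]
    · rw [key]
      exact h2'
    · funext x
      have := congrFun h3 (γ x)
      have hx := h2 x
      by_cases h : x ∈ V
      · have h' := hx.1 h
        simpa [restrict, psmul, h, h'] using this
      · have h' : γ x ∉ V := fun t => h (hx.2 t)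
        simpa [restrict, psmul, h, h'] using this

end PrefixAssignment
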